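/- Let S be a commutative ring with unit, let R be a commutative unital S-algebra, and let E be a graph. Then L_R(E) ≅ R ⊗_S L_S(E) as R-algebras, where the isomorphism sends v ↦ 1 ⊗ v, e ↦ 1 ⊗ e, and e* ↦ 1 ⊗ e* for all vertices v and edges e. -/

import Mathlib

set_option maxHeartbeats 1000000
set_option synthInstance.maxHeartbeats 400000

noncomputable section

/-- A directed graph `E = (E⁰, E¹, r, s)` with countable vertex and edge sets,
together with range and source maps. -/
structure LPAGraph : Type 1 where
  V : Type
  E : Type
  countV : Countable V
  countE : Countable E
  src : E → V
  rng : E → V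

namespace LPAGraph

/-- Generators of the Leavitt path algebra: vertices, real edges, and ghost edges. -/
inductive LGen (G : LPAGraph) : Type
  | vert : G.V → LGen G
  | edge : G.E → LGen G
  | ghost : G.E → LGen G

/-- `IsPathFrom G u es w` : the list of edges `es` is a path from `u` to `w`
(paths of length zero are vertices). -/
inductive IsPathFrom (G : LPAGraph) : G.V → List G.E → G.V → Prop
  | nil (v : G.V) : IsPathFrom G v [] v
  | cons {u w : G.V} (e : G.E) {es : List G.E} (h : G.src e = u)
      (ht : IsPathFrom G (G.rng e) es w) : IsPathFrom G u (e :: es) w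

/-- A vertex is regular if it emits at least one and only finitely many edges. -/
def Regular (G : LPAGraph) (v : G.V) : Prop :=
  {e : G.E | G.src e = v}.Finite ∧ {e : G.E | G.src e = v}.Nonempty

/-- A graph is row-finite if every vertex emits only finitely many edges. -/
def RowFinite (G : LPAGraph) : Prop := ∀ v : G.V, {e : G.E | G.src e = v}.Finite

/-- A subset `H` of vertices is hereditary if `s(e) ∈ H` implies `r(e) ∈ H`. -/
def Hereditary (G : LPAGraph) (H : Set G.V) : Prop :=
  ∀ e : G.E, G.src e ∈ H → G.rng e ∈ H

/-- A subset `H` of vertices is saturated if every regular vertex, all of whose emitted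
edges have range in `H`, belongs to `H`. -/
def Saturated (G : LPAGraph) (H : Set G.V) : Prop :=
  ∀ v : G.V, G.Regular v → (∀ e : G.E, G.src e = v → G.rng e ∈ H) → v ∈ H

/-- The saturation of a set of vertices: the smallest saturated hereditary subset
containing it. -/
def saturation (G : LPAGraph) (X : Set G.V) : Set G.V :=
  ⋂₀ {H : Set G.V | G.Hereditary H ∧ G.Saturated H ∧ X ⊆ H}

/-- `HasExit G es` : the path `es` has an exit, i.e. there is an edge `f` with
`s(f) = s(eᵢ)` and `f ≠ eᵢ` for some `i`. -/
def HasExit (G : LPAGraph) (es : List G.E) : Prop :=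
  ∃ (f : G.E) (i : Fin es.length), G.src f = G.src (es.get i) ∧ f ≠ es.get i

/-- Condition (L): every cycle has an exit. -/
def CondL (G : LPAGraph) : Prop :=
  ∀ (v : G.V) (es : List G.E), es ≠ [] → IsPathFrom G v es v → G.HasExit es

/-- A closed path based at `v`. -/
def IsClosedPathAt (G : LPAGraph) (v : G.V) (es : List G.E) : Prop :=
  es ≠ [] ∧ IsPathFrom G v es v

/-- A simple closed path based at `v` : a closed path `e₁ … eₙ` based at `v` with
`s(eᵢ) ≠ v` for `i = 2, …, n`. -/
def IsSimpleClosedPathAt (G : LPAGraph) (v : G.V) (es : List G.E) : Prop :=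
  G.IsClosedPathAt v es ∧ ∀ i : Fin es.length, i.1 ≠ 0 → G.src (es.get i) ≠ v

/-- Condition (K): every vertex is the base of no closed path or of at least two
distinct simple closed paths. -/
def CondK (G : LPAGraph) : Prop :=
  ∀ v : G.V, (¬ ∃ es : List G.E, G.IsClosedPathAt v es) ∨
    (∃ es₁ es₂ : List G.E, G.IsSimpleClosedPathAt v es₁ ∧ G.IsSimpleClosedPathAt v es₂ ∧
      es₁ ≠ es₂)

variable (R : Type) [CommRing R] (G : LPAGraph)

open FreeAlgebra in
/-- The defining relations of the Leavitt path algebra (the relations of a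
Leavitt `E`-family). -/
inductive LeavittRel : FreeAlgebra R (LGen G) → FreeAlgebra R (LGen G) → Prop
  | vert_mul_self (v : G.V) :
      LeavittRel (ι R (LGen.vert v) * ι R (LGen.vert v)) (ι R (LGen.vert v))
  | vert_mul_vert (v w : G.V) (hvw : v ≠ w) :
      LeavittRel (ι R (LGen.vert v) * ι R (LGen.vert w)) 0
  | src_mul_edge (e : G.E) :
      LeavittRel (ι R (LGen.vert (G.src e)) * ι R (LGen.edge e)) (ι R (LGen.edge e))
  | edge_mul_rng (e : G.E) :
      LeavittRel (ι R (LGen.edge e) * ι R (LGen.vert (G.rng e))) (ι R (LGen.edge e))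
  | rng_mul_ghost (e : G.E) :
      LeavittRel (ι R (LGen.vert (G.rng e)) * ι R (LGen.ghost e)) (ι R (LGen.ghost e))
  | ghost_mul_src (e : G.E) :
      LeavittRel (ι R (LGen.ghost e) * ι R (LGen.vert (G.src e))) (ι R (LGen.ghost e))
  | ghost_mul_self (e : G.E) :
      LeavittRel (ι R (LGen.ghost e) * ι R (LGen.edge e)) (ι R (LGen.vert (G.rng e)))
  | ghost_mul_edge (e f : G.E) (hef : e ≠ f) :
      LeavittRel (ι R (LGen.ghost e) * ι R (LGen.edge f)) 0
  | ck (v : G.V) (s : Finset G.E) (hs : ∀ e : G.E, e ∈ s ↔ G.src e = v) (hne : s.Nonempty) :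
      LeavittRel (ι R (LGen.vert v)) (∑ e ∈ s, ι R (LGen.edge e) * ι R (LGen.ghost e))

/-- The ambient unital algebra: the universal unital `R`-algebra on the Leavitt relations. -/
abbrev Ambient : Type := RingQuot (LeavittRel R G)

/-- The images of the generators in the ambient algebra. -/
def ugen (x : LGen G) : Ambient R G :=
  RingQuot.mkAlgHom R (LeavittRel R G) (FreeAlgebra.ι R x)

/-- The Leavitt path algebra `L_R(E)`, realized as the non-unital subalgebra of the ambient
algebra generated by the Leavitt `E`-family (equivalently, the span of words in the
generators). -/
def LeavittSubalgebra : NonUnitalSubalgebra R (Ambient R G) :=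
  NonUnitalAlgebra.adjoin R (Set.range (ugen R G))

/-- The Leavitt path algebra `L_R(E)` as a type; it is a non-unital `R`-algebra. -/
abbrev LeavittPathAlgebra : Type := ↥(LeavittSubalgebra R G)

theorem ugen_mem (x : LGen G) : ugen R G x ∈ LeavittSubalgebra R G :=
  NonUnitalAlgebra.subset_adjoin R (Set.mem_range_self x)

/-- The vertex idempotent `v ∈ L_R(E)`. -/
def vertexElem (v : G.V) : LeavittPathAlgebra R G :=
  ⟨ugen R G (LGen.vert v), ugen_mem R G _⟩

/-- The real edge `e ∈ L_R(E)`. -/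
def edgeElem (e : G.E) : LeavittPathAlgebra R G :=
  ⟨ugen R G (LGen.edge e), ugen_mem R G _⟩

/-- The ghost edge `e* ∈ L_R(E)`. -/
def ghostElem (e : G.E) : LeavittPathAlgebra R G :=
  ⟨ugen R G (LGen.ghost e), ugen_mem R G _⟩

/-- The element `α = e₁ ⋯ eₙ` of the ambient algebra corresponding to a path; a path of
length zero starting at `u` is the vertex `u`. -/
def uPath (u : G.V) (es : List G.E) : Ambient R G :=
  ugen R G (LGen.vert u) * (es.map fun e => ugen R G (LGen.edge e)).prod

/-- The element `α* = eₙ* ⋯ e₁*` of the ambient algebra corresponding to a ghost path. -/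
def uGhostPath (u : G.V) (es : List G.E) : Ambient R G :=
  ((es.map fun e => ugen R G (LGen.ghost e)).reverse).prod * ugen R G (LGen.vert u)

private theorem list_prod_mem_aux (f : G.E → Ambient R G)
    (hf : ∀ e, f e ∈ LeavittSubalgebra R G) :
    ∀ es : List G.E, es ≠ [] → (es.map f).prod ∈ LeavittSubalgebra R G
  | [], h => absurd rfl h
  | [e], _ => by simpa using hf e
  | e :: e' :: t, _ => by
      rw [List.map_cons, List.prod_cons]
      exact mul_mem (hf e) (list_prod_mem_aux f hf (e' :: t) (by simp))

theorem uPath_mem (u : G.V) (es : List G.E) : uPath R G u es ∈ LeavittSubalgebra R G := by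
  cases es with
  | nil => simpa [uPath] using ugen_mem R G (LGen.vert u)
  | cons e t =>
      exact mul_mem (ugen_mem R G (LGen.vert u))
        (list_prod_mem_aux R G _ (fun e => ugen_mem R G (LGen.edge e)) (e :: t) (by simp))

theorem uGhostPath_mem (u : G.V) (es : List G.E) :
    uGhostPath R G u es ∈ LeavittSubalgebra R G := by
  cases es with
  | nil => simpa [uGhostPath] using ugen_mem R G (LGen.vert u)
  | cons e t =>
      rw [uGhostPath, ← List.map_reverse]
      exact mul_mem
        (list_prod_mem_aux R G _ (fun e => ugen_mem R G (LGen.ghost e)) ((e :: t).reverse)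
          (by simp))
        (ugen_mem R G (LGen.vert u))

/-- The element of `L_R(E)` corresponding to the path `α` with source `u` and edge list
`es` (for `es = []` this is the vertex `u`). -/
def pathElem (u : G.V) (es : List G.E) : LeavittPathAlgebra R G :=
  ⟨uPath R G u es, uPath_mem R G u es⟩

/-- The element of `L_R(E)` corresponding to the ghost path `α*` where `α` has source `u`
and edge list `es` (for `es = []` this is the vertex `u`). -/
def ghostPathElem (u : G.V) (es : List G.E) : LeavittPathAlgebra R G :=
  ⟨uGhostPath R G u es, uGhostPath_mem R G u es⟩

/-- The set of monomials `α β*` where `α, β` are paths with `r(α) = r(β)`. -/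
def monomialSet : Set (LeavittPathAlgebra R G) :=
  {x | ∃ (u : G.V) (es : List G.E) (u' : G.V) (es' : List G.E) (w : G.V),
    IsPathFrom G u es w ∧ IsPathFrom G u' es' w ∧
    x = pathElem R G u es * ghostPathElem R G u' es'}

/-- The degree-`k` homogeneous component `L_R(E)ₖ` of the canonical `ℤ`-grading:
the `R`-span of the monomials `α β*` with `|α| - |β| = k`. -/
def component (k : ℤ) : Submodule R (LeavittPathAlgebra R G) :=
  Submodule.span R
    {x | ∃ (u : G.V) (es : List G.E) (u' : G.V) (es' : List G.E) (w : G.V),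
      IsPathFrom G u es w ∧ IsPathFrom G u' es' w ∧
      (es.length : ℤ) - (es'.length : ℤ) = k ∧
      x = pathElem R G u es * ghostPathElem R G u' es'}

/-- An ideal `I` of `L_R(E)` is basic if `r • v ∈ I` with `r ∈ R \ {0}` and `v` a vertex
implies `v ∈ I`. -/
def IsBasicIdeal (I : TwoSidedIdeal (LeavittPathAlgebra R G)) : Prop :=
  ∀ (r : R) (v : G.V), r ≠ 0 → r • vertexElem R G v ∈ I → vertexElem R G v ∈ I

/-- An ideal `I` of the `ℤ`-graded ring `L_R(E)` is graded if `I = ⊕ₖ (I ∩ L_R(E)ₖ)`,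
i.e. every element of `I` is a finite sum of homogeneous elements of `I`. -/
def IsGradedIdeal (I : TwoSidedIdeal (LeavittPathAlgebra R G)) : Prop :=
  ∀ x ∈ I, ∃ (n : ℕ) (c : Fin n → LeavittPathAlgebra R G),
    (∀ i, c i ∈ I ∧ ∃ k : ℤ, c i ∈ component R G k) ∧ x = ∑ i, c i

/-- The two-sided ideal of `L_R(E)` generated by the vertices in a set `H` of vertices. -/
def idealOfSet (H : Set G.V) : TwoSidedIdeal (LeavittPathAlgebra R G) :=
  TwoSidedIdeal.span {x | ∃ v ∈ H, x = vertexElem R G v}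

/-- `x ∈ L_R(E)` is a polynomial in only real edges if it is an `R`-linear combination of
(real) paths. -/
def IsRealPoly (x : LeavittPathAlgebra R G) : Prop :=
  x ∈ Submodule.span R
    {y | ∃ (u : G.V) (es : List G.E) (w : G.V), IsPathFrom G u es w ∧ y = pathElem R G u es}

end LPAGraph
namespace LPAGraph
open TensorProduct

/-- Generators as elements of the Leavitt path algebra. -/
def lgen (R : Type) [CommRing R] (G : LPAGraph) (x : LGen G) : LeavittPathAlgebra R G :=
  ⟨ugen R G x, ugen_mem R G x⟩

/-- Universal property of the Leavitt path algebra. -/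
theorem exists_lift (R : Type) [CommRing R] (G : LPAGraph) {A : Type} [NonUnitalRing A]
    [Module R A] [IsScalarTower R A A] [SMulCommClass R A A] (f : LGen G → A)
    (hf : ∀ a b, LeavittRel R G a b →
      FreeAlgebra.lift R (fun x => (Unitization.inr (f x) : Unitization R A)) a =
      FreeAlgebra.lift R (fun x => (Unitization.inr (f x) : Unitization R A)) b) :
    ∃ φ : LeavittPathAlgebra R G →ₙₐ[R] A, ∀ x, φ (lgen R G x) = f x := by
  let F : Ambient R G →ₐ[R] Unitization R A :=
    RingQuot.liftAlgHom R ⟨FreeAlgebra.lift R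
      (fun x => (Unitization.inr (f x) : Unitization R A)), fun a b h => hf a b h⟩
  have hF : ∀ x, F (ugen R G x) = Unitization.inr (f x) := by
    intro x
    simp [F, ugen]
  have h0 : ∀ y ∈ LeavittSubalgebra R G, (F y).fst = 0 := by
    intro y hy
    refine NonUnitalAlgebra.adjoin_induction (p := fun y _ => (F y).fst = 0)
      ?_ ?_ ?_ ?_ ?_ hy
    · rintro _ ⟨x, rfl⟩
      simp [hF]
    · intro a b _ _ ha hb
      simp [ha, hb]
    · simp
    · intro a b _ _ ha hb
      simp [ha]
    · intro r a _ ha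
      simp [ha]
  refine ⟨{ toFun := fun y => (F y.1).snd
            map_smul' := fun r y => by simp
            map_zero' := by simp
            map_add' := fun a b => by simp
            map_mul' := fun a b => by simp [h0 a.1 a.2, h0 b.1 b.2] }, fun x => ?_⟩
  show (F (ugen R G x)).snd = f x
  simp [hF]

theorem ugen_rel (R : Type) [CommRing R] (G : LPAGraph) {a b : FreeAlgebra R (LGen G)}
    (h : LeavittRel R G a b) :
    FreeAlgebra.lift R (ugen R G) a = FreeAlgebra.lift R (ugen R G) b := by
  have : FreeAlgebra.lift R (ugen R G) = RingQuot.mkAlgHom R (LeavittRel R G) := by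
    ext x
    simp [ugen]
  rw [this]
  exact RingQuot.mkAlgHom_rel R h

theorem exists_base (S : Type) [CommRing S] (R : Type) [CommRing R] [Algebra S R]
    (G : LPAGraph) :
    ∃ j : Ambient S G →ₐ[S] Ambient R G, ∀ x, j (ugen S G x) = ugen R G x := by
  suffices H : ∀ ⦃a b⦄, LeavittRel S G a b →
      FreeAlgebra.lift S (ugen R G) a = FreeAlgebra.lift S (ugen R G) b by
    refine ⟨RingQuot.liftAlgHom S ⟨FreeAlgebra.lift S (ugen R G), H⟩, fun x => ?_⟩
    rw [ugen, RingQuot.liftAlgHom_mkAlgHom_apply, FreeAlgebra.lift_ι_apply]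
  intro a b h
  cases h with
  | vert_mul_self v => simpa using ugen_rel R G (.vert_mul_self v)
  | vert_mul_vert v w h => simpa using ugen_rel R G (.vert_mul_vert v w h)
  | src_mul_edge e => simpa using ugen_rel R G (.src_mul_edge e)
  | edge_mul_rng e => simpa using ugen_rel R G (.edge_mul_rng e)
  | rng_mul_ghost e => simpa using ugen_rel R G (.rng_mul_ghost e)
  | ghost_mul_src e => simpa using ugen_rel R G (.ghost_mul_src e)
  | ghost_mul_self e => simpa using ugen_rel R G (.ghost_mul_self e)
  | ghost_mul_edge e f h => simpa using ugen_rel R G (.ghost_mul_edge e f h)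
  | ck v s hs hne => simpa using ugen_rel R G (.ck v s hs hne)

theorem exists_phi (S : Type) [CommRing S] (R : Type) [CommRing R] [Algebra S R]
    (G : LPAGraph) :
    ∃ φ : LeavittPathAlgebra R G →ₙₐ[R] (R ⊗[S] LeavittPathAlgebra S G),
      ∀ x, φ (lgen R G x) = 1 ⊗ₜ[S] lgen S G x := by
  refine exists_lift R G (fun x => (1 : R) ⊗ₜ[S] lgen S G x) ?_
  have key : ∀ x y, lgen S G x * lgen S G y = ⟨ugen S G x * ugen S G y,
    mul_mem (ugen_mem S G x) (ugen_mem S G y)⟩ := fun _ _ => rfl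
  intro a b h
  cases h with
  | vert_mul_self v =>
    have h1 : lgen S G (.vert v) * lgen S G (.vert v) = lgen S G (.vert v) :=
      Subtype.ext (by simpa [lgen] using ugen_rel S G (.vert_mul_self v))
    simp [← Unitization.inr_mul, h1]
  | vert_mul_vert v w h =>
    have h1 : lgen S G (.vert v) * lgen S G (.vert w) = 0 :=
      Subtype.ext (by simpa [lgen] using ugen_rel S G (.vert_mul_vert v w h))
    simp [← Unitization.inr_mul, h1]
  | src_mul_edge e =>
    have h1 : lgen S G (.vert (G.src e)) * lgen S G (.edge e) = lgen S G (.edge e) :=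
      Subtype.ext (by simpa [lgen] using ugen_rel S G (.src_mul_edge e))
    simp [← Unitization.inr_mul, h1]
  | edge_mul_rng e =>
    have h1 : lgen S G (.edge e) * lgen S G (.vert (G.rng e)) = lgen S G (.edge e) :=
      Subtype.ext (by simpa [lgen] using ugen_rel S G (.edge_mul_rng e))
    simp [← Unitization.inr_mul, h1]
  | rng_mul_ghost e =>
    have h1 : lgen S G (.vert (G.rng e)) * lgen S G (.ghost e) = lgen S G (.ghost e) :=
      Subtype.ext (by simpa [lgen] using ugen_rel S G (.rng_mul_ghost e))
    simp [← Unitization.inr_mul, h1]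
  | ghost_mul_src e =>
    have h1 : lgen S G (.ghost e) * lgen S G (.vert (G.src e)) = lgen S G (.ghost e) :=
      Subtype.ext (by simpa [lgen] using ugen_rel S G (.ghost_mul_src e))
    simp [← Unitization.inr_mul, h1]
  | ghost_mul_self e =>
    have h1 : lgen S G (.ghost e) * lgen S G (.edge e) = lgen S G (.vert (G.rng e)) :=
      Subtype.ext (by simpa [lgen] using ugen_rel S G (.ghost_mul_self e))
    simp [← Unitization.inr_mul, h1]
  | ghost_mul_edge e f h =>
    have h1 : lgen S G (.ghost e) * lgen S G (.edge f) = 0 :=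
      Subtype.ext (by simpa [lgen] using ugen_rel S G (.ghost_mul_edge e f h))
    simp [← Unitization.inr_mul, h1]
  | ck v s hs hne =>
    have h1 : lgen S G (.vert v) = ∑ e ∈ s, lgen S G (.edge e) * lgen S G (.ghost e) :=
      Subtype.ext (by
        simpa [lgen] using ugen_rel S G (.ck v s hs hne))
    have h2 : ∀ (t : Finset G.E) (g : G.E → R ⊗[S] LeavittPathAlgebra S G),
        (Unitization.inr (∑ e ∈ t, g e) : Unitization R (R ⊗[S] LeavittPathAlgebra S G))
          = ∑ e ∈ t, Unitization.inr (g e) := fun t g =>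
      map_sum (Unitization.inrNonUnitalAlgHom R (R ⊗[S] LeavittPathAlgebra S G)) g t
    simp [← Unitization.inr_mul, h1, TensorProduct.tmul_sum, h2]

end LPAGraph

open LPAGraph TensorProduct in
/-- **Theorem (change of coefficients).**  Let `S` be a commutative ring with unit, `R` a
commutative unital `S`-algebra, and `E` a graph.  Then `L_R(E) ≅ R ⊗_S L_S(E)` as
`R`-algebras, via an isomorphism sending `v ↦ 1 ⊗ v`, `e ↦ 1 ⊗ e`, and `e* ↦ 1 ⊗ e*`. -/
theorem stmt19 (S : Type) [CommRing S] (R : Type) [CommRing R] [Algebra S R]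
    (G : LPAGraph) :
    ∃ φ : LeavittPathAlgebra R G →ₙₐ[R] (R ⊗[S] LeavittPathAlgebra S G),
      Function.Bijective φ ∧
      (∀ v : G.V, φ (vertexElem R G v) = 1 ⊗ₜ[S] vertexElem S G v) ∧
      (∀ e : G.E, φ (edgeElem R G e) = 1 ⊗ₜ[S] edgeElem S G e) ∧
      (∀ e : G.E, φ (ghostElem R G e) = 1 ⊗ₜ[S] ghostElem S G e) := by
  obtain ⟨φ, hφ⟩ := exists_phi S R G
  obtain ⟨j, hj⟩ := exists_base S R G
  refine ⟨φ, ⟨?_, ?_⟩, fun v => hφ _, fun v => hφ _, fun v => hφ _⟩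
  · let ψ : R ⊗[S] LeavittPathAlgebra S G →ₗ[S] Ambient R G :=
      TensorProduct.lift
        { toFun := fun r =>
            { toFun := fun x => r • j x.1
              map_add' := fun x y => by simp
              map_smul' := fun s x => by
                have h := map_smul j s x.1
                simp only [NonUnitalSubalgebra.coe_smul, RingHom.id_apply]
                rw [h]
                exact smul_comm r s (j x.1) }
          map_add' := fun a b => by ext x; simp [add_smul]
          map_smul' := fun s a => by ext x; simp }
    have hψ : ∀ r x, ψ (r ⊗ₜ x) = r • j x.1 := fun r x => rfl
    have hmul : ∀ a b, ψ (a * b) = ψ a * ψ b := by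
      intro a b
      induction a with
      | zero => simp
      | add a a' h h' => simp [add_mul, h, h']
      | tmul r x =>
        induction b with
        | zero => simp
        | add a a' h h' => simp [mul_add, h, h']
        | tmul r' x' =>
          simp [hψ, Algebra.TensorProduct.tmul_mul_tmul, smul_smul, mul_comm]
    have hsm : ∀ (r : R) a, ψ (r • a) = r • ψ a := by
      intro r a
      induction a with
      | zero => simp
      | add a a' h h' => simp [h, h']
      | tmul r' x => simp [hψ, TensorProduct.smul_tmul', smul_smul]
    have hinv : ∀ y (hy : y ∈ LeavittSubalgebra R G), ψ (φ ⟨y, hy⟩) = y := by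
      intro y hy
      refine NonUnitalAlgebra.adjoin_induction
        (p := fun y hy => ψ (φ ⟨y, hy⟩) = y) ?_ ?_ ?_ ?_ ?_ hy
      · rintro _ ⟨x, rfl⟩
        refine (congrArg ψ (hφ x)).trans ?_
        rw [hψ, one_smul]
        exact hj x
      · intro a b ha hb h h'
        refine (congrArg ψ (map_add φ ⟨a, ha⟩ ⟨b, hb⟩)).trans ?_
        rw [map_add, h, h']
      · exact (congrArg ψ (map_zero φ)).trans (map_zero ψ)
      · intro a b ha hb h h'
        refine (congrArg ψ (map_mul φ ⟨a, ha⟩ ⟨b, hb⟩)).trans ?_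
        rw [hmul, h, h']
      · intro r a ha h
        refine (congrArg ψ (map_smul φ r ⟨a, ha⟩)).trans ?_
        rw [hsm, h]
    intro a b hab
    apply Subtype.ext
    rw [← hinv a.1 a.2, ← hinv b.1 b.2]
    exact congrArg ψ hab
  · have h1 : ∀ y (hy : y ∈ LeavittSubalgebra S G), ∃ z, φ z = 1 ⊗ₜ[S] ⟨y, hy⟩ := by
      intro y hy
      refine NonUnitalAlgebra.adjoin_induction
        (p := fun y hy => ∃ z, φ z = 1 ⊗ₜ[S] ⟨y, hy⟩) ?_ ?_ ?_ ?_ ?_ hy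
      · rintro _ ⟨x, rfl⟩
        exact ⟨_, hφ x⟩
      · rintro a b ha hb ⟨z, h⟩ ⟨z', h'⟩
        refine ⟨z + z', ?_⟩
        rw [map_add, h, h', ← TensorProduct.tmul_add]
        rfl
      · exact ⟨0, (map_zero φ).trans (TensorProduct.tmul_zero _ _).symm⟩
      · rintro a b ha hb ⟨z, h⟩ ⟨z', h'⟩
        refine ⟨z * z', ?_⟩
        rw [map_mul, h, h', Algebra.TensorProduct.tmul_mul_tmul, one_mul]
        rfl
      · rintro s a ha ⟨z, h⟩
        refine ⟨algebraMap S R s • z, ?_⟩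
        rw [map_smul, h, algebraMap_smul, ← TensorProduct.tmul_smul]
        rfl
    intro t
    induction t with
    | zero => exact ⟨0, map_zero φ⟩
    | add a b ha hb =>
      obtain ⟨z, rfl⟩ := ha
      obtain ⟨z', rfl⟩ := hb
      exact ⟨z + z', map_add φ _ _⟩
    | tmul r x =>
      obtain ⟨z, hz⟩ := h1 x.1 x.2
      refine ⟨r • z, ?_⟩
      rw [map_smul, hz, TensorProduct.smul_tmul', smul_eq_mul, mul_one]
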